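/- Let f : ℕ → ℕ be strictly increasing. For any activator sequence (v_n, n ≥ 1) on G(f) and any time t: (a) for each i ≤ t with v_i ≠ ∅, B_t[i] equals the L¹-ball of radius t−i centred at v_i in ℤ × ℤ; and (b) |B_t| ≤ (2t³ + t)/3. -/

import Mathlib

open Filter Asymptotics

/-- Membership in the grid `[-f n, f n]^2 ⊆ ℤ × ℤ`. -/
def inGrid (f : ℕ → ℕ) (n : ℕ) (p : ℤ × ℤ) : Prop :=
  |p.1| ≤ (f n : ℤ) ∧ |p.2| ≤ (f n : ℤ)

instance (f : ℕ → ℕ) (n : ℕ) : DecidablePred (inGrid f n) := fun _ => by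
  unfold inGrid; infer_instance

/-- The four lattice neighbours (at `L¹`-distance one) of a point. -/
def nbrs (p : ℤ × ℤ) : Finset (ℤ × ℤ) :=
  {(p.1 + 1, p.2), (p.1 - 1, p.2), (p.1, p.2 + 1), (p.1, p.2 - 1)}

/-- An activator sequence: whenever `V n ≠ ∅` (for `n ≥ 1`), the activated vertex
lies in the grid at time `n`. -/
def IsActivator (f : ℕ → ℕ) (V : ℕ → Option (ℤ × ℤ)) : Prop :=
  ∀ n, 1 ≤ n → ∀ p, V n = some p → inGrid f n p

/-- The burning process: `B 0 = ∅`, and `B n` is obtained from `B (n-1)` by adding all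
vertices of the grid at time `n` adjacent to a vertex of `B (n-1)`, and then adding
the activator `V n` if it is not `∅`. -/
def burnSet (f : ℕ → ℕ) (V : ℕ → Option (ℤ × ℤ)) : ℕ → Finset (ℤ × ℤ)
  | 0 => ∅
  | n + 1 =>
    let B := burnSet f V n
    let spread := B ∪ (B.biUnion nbrs).filter (inGrid f (n + 1))
    match V (n + 1) with
    | none => spread
    | some v => insert v spread

/-- The proportion `|B n| / |V(G n)|` of burning vertices at time `n`. -/
noncomputable def densitySeq (f : ℕ → ℕ) (V : ℕ → Option (ℤ × ℤ)) (n : ℕ) : ℝ :=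
  ((burnSet f V n).card : ℝ) / (2 * (f n : ℝ) + 1) ^ 2

/-- The lower burning density `δ̲(G(f), V)`. -/
noncomputable def lowerDensity (f : ℕ → ℕ) (V : ℕ → Option (ℤ × ℤ)) : ℝ :=
  liminf (densitySeq f V) atTop

/-- The upper burning density `δ̄(G(f), V)`. -/
noncomputable def upperDensity (f : ℕ → ℕ) (V : ℕ → Option (ℤ × ℤ)) : ℝ :=
  limsup (densitySeq f V) atTop

/-- The burning density of `V` in `G(f)` exists and equals `ρ`. -/
def HasBurningDensity (f : ℕ → ℕ) (V : ℕ → Option (ℤ × ℤ)) (ρ : ℝ) : Prop :=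
  Tendsto (densitySeq f V) atTop (nhds ρ)

/-- `P(G(f))`: the set of `ρ ∈ [0,1]` achievable as the burning density of some
non-empty activator sequence. -/
def densSet (f : ℕ → ℕ) : Set ℝ :=
  {ρ | ρ ∈ Set.Icc (0 : ℝ) 1 ∧
    ∃ V : ℕ → Option (ℤ × ℤ), IsActivator f V ∧ (∃ t, 1 ≤ t ∧ V t ≠ none) ∧
      HasBurningDensity f V ρ}

/-- The controlled growth requirement. -/
def ControlledGrowth (f : ℕ → ℕ) : Prop :=
  (∀ᶠ n in atTop, f n < f (n + 1)) ∧
  (∀ ε : ℕ → ℕ, (fun n => (ε n : ℝ)) =o[atTop] (fun n => (n : ℝ)) →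
    Tendsto (fun n => (f (n + ε n) : ℝ) / (f n : ℝ)) atTop (nhds 1)) ∧
  (∀ c : ℝ, 0 < c → ∃ d : ℝ, 0 < d ∧
    ∀ᶠ n in atTop, (1 + d) * (f n : ℝ) ≤ (f (n + ⌈c * n⌉₊) : ℝ))

/-- The activator sequence that activates only the `i`-th vertex of `V`, at time `i`. -/
def singleAct (V : ℕ → Option (ℤ × ℤ)) (i : ℕ) : ℕ → Option (ℤ × ℤ) :=
  fun n => if n = i then V i else none

theorem mem_nbrs {p q : ℤ × ℤ} : q ∈ nbrs p ↔ |q.1 - p.1| + |q.2 - p.2| = 1 := by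
  simp only [nbrs, Finset.mem_insert, Finset.mem_singleton, Prod.ext_iff]
  grind

theorem mem_burnSet_succ {f : ℕ → ℕ} {V : ℕ → Option (ℤ × ℤ)} {n : ℕ} {q : ℤ × ℤ} :
    q ∈ burnSet f V (n + 1) ↔ V (n + 1) = some q ∨ q ∈ burnSet f V n ∨
      (∃ p ∈ burnSet f V n, |q.1 - p.1| + |q.2 - p.2| = 1) ∧ inGrid f (n + 1) q := by
  rw [burnSet]
  cases V (n + 1) <;> simp [← mem_nbrs, eq_comm]

theorem burnSet_singleAct_eq_empty {f : ℕ → ℕ} {V : ℕ → Option (ℤ × ℤ)} {i n : ℕ} (h : n < i) :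
    burnSet f (singleAct V i) n = ∅ := by
  induction n with
  | zero => rfl
  | succ n ih =>
    ext q
    simp [mem_burnSet_succ, ih (by omega), singleAct, h.ne]

theorem exists_near_of_l1_le_succ {p q : ℤ × ℤ} {r : ℤ}
    (h : |q.1 - p.1| + |q.2 - p.2| ≤ r + 1) (hr : r < |q.1 - p.1| + |q.2 - p.2|)
    (hr₀ : 0 ≤ r) :
    ∃ q' : ℤ × ℤ, |q'.1 - p.1| + |q'.2 - p.2| ≤ r ∧ |q.1 - q'.1| + |q.2 - q'.2| = 1 := by
  rcases lt_trichotomy q.1 p.1 with h₁ | h₁ | h₁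
  · exact ⟨(q.1 + 1, q.2), by grind, by grind⟩
  · rcases lt_or_ge q.2 p.2 with h₂ | h₂
    · exact ⟨(q.1, q.2 + 1), by grind, by grind⟩
    · exact ⟨(q.1, q.2 - 1), by grind, by grind⟩
  · exact ⟨(q.1 - 1, q.2), by grind, by grind⟩

theorem inGrid_of_l1_le {f : ℕ → ℕ} (hf : StrictMono f) {i k : ℕ} {p q : ℤ × ℤ}
    (hp : inGrid f i p) (h : |q.1 - p.1| + |q.2 - p.2| ≤ k) : inGrid f (i + k) q := by
  have hik : f i + k ≤ f (i + k) := by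
    simpa [add_comm] using hf.add_le_nat k i
  unfold inGrid at *
  grind

theorem mem_burnSet_singleAct {f : ℕ → ℕ} (hf : StrictMono f) {V : ℕ → Option (ℤ × ℤ)}
    {i : ℕ} {p : ℤ × ℤ} (hi : 1 ≤ i) (hV : V i = some p) (hp : inGrid f i p) (k : ℕ)
    (q : ℤ × ℤ) :
    q ∈ burnSet f (singleAct V i) (i + k) ↔ |q.1 - p.1| + |q.2 - p.2| ≤ k := by
  induction k generalizing q with
  | zero =>
    obtain ⟨j, rfl⟩ := Nat.exists_eq_add_of_le' hi
    rw [add_zero, mem_burnSet_succ, burnSet_singleAct_eq_empty (Nat.lt_succ_self j)]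
    simp only [singleAct, if_true, hV, Option.some.injEq, Prod.ext_iff]
    grind
  | succ k ih =>
    rw [← add_assoc, mem_burnSet_succ]
    simp only [ih]
    have hne : singleAct V i (i + k + 1) ≠ some q := by
      simp [singleAct, show i + k + 1 ≠ i by omega]
    constructor
    · rintro (h | h | ⟨⟨q', h, h'⟩, -⟩)
      · exact absurd h hne
      · push_cast; linarith
      · push_cast
        linarith [abs_sub_le q.1 q'.1 p.1, abs_sub_le q.2 q'.2 p.2]
    · intro h
      push_cast at h
      by_cases hr : |q.1 - p.1| + |q.2 - p.2| ≤ k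
      · exact .inr (.inl hr)
      · exact .inr (.inr ⟨exists_near_of_l1_le_succ h (not_le.1 hr) (by positivity),
          inGrid_of_l1_le (k := k + 1) hf hp (by exact_mod_cast h)⟩)

/-- The closed `L¹`-ball of radius `r` around `p`, as the union of its two sublattices of
points `q` for which the coordinate sum of `q - p` has the parity of `r`, respectively of
`r - 1`. -/
def l1Ball (p : ℤ × ℤ) (r : ℕ) : Finset (ℤ × ℤ) :=
  (Finset.range (r + 1) ×ˢ Finset.range (r + 1)).image
      (fun a => (p.1 + a.1 + a.2 - r, p.2 + a.1 - a.2)) ∪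
    (Finset.range r ×ˢ Finset.range r).image
      (fun a => (p.1 + a.1 + a.2 - r + 1, p.2 + a.1 - a.2))

theorem card_l1Ball_le (p : ℤ × ℤ) (r : ℕ) : (l1Ball p r).card ≤ 2 * r ^ 2 + 2 * r + 1 := by
  refine (Finset.card_union_le _ _).trans
    ((add_le_add Finset.card_image_le Finset.card_image_le).trans_eq ?_)
  simp only [Finset.card_product, Finset.card_range]
  ring

theorem mem_l1Ball_of_le {p q : ℤ × ℤ} {r : ℕ} (h : |q.1 - p.1| + |q.2 - p.2| ≤ r) :
    q ∈ l1Ball p r := by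
  simp only [l1Ball, Finset.mem_union, Finset.mem_image, Finset.mem_product, Finset.mem_range,
    Prod.ext_iff, Prod.exists]
  have h₁ := abs_le.1 ((abs_add_le (q.1 - p.1) (q.2 - p.2)).trans h)
  have h₂ := abs_le.1 ((abs_sub (q.1 - p.1) (q.2 - p.2)).trans h)
  rcases Int.emod_two_eq (q.1 - p.1 + (q.2 - p.2) + r) with h₀ | h₀
  · exact .inl ⟨((q.1 - p.1 + (q.2 - p.2) + r) / 2).toNat,
      ((q.1 - p.1 - (q.2 - p.2) + r) / 2).toNat, by omega, by omega, by omega⟩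
  · exact .inr ⟨((q.1 - p.1 + (q.2 - p.2) + r) / 2).toNat,
      ((q.1 - p.1 - (q.2 - p.2) + r) / 2).toNat, by omega, by omega, by omega⟩

theorem exists_activator_near {f : ℕ → ℕ} {V : ℕ → Option (ℤ × ℤ)} {t : ℕ} {q : ℤ × ℤ}
    (hq : q ∈ burnSet f V t) :
    ∃ k < t, ∃ p, V (t - k) = some p ∧ |q.1 - p.1| + |q.2 - p.2| ≤ k := by
  induction t generalizing q with
  | zero => simp [burnSet] at hq
  | succ t ih =>
    rcases mem_burnSet_succ.1 hq with h | h | ⟨⟨q', h, h'⟩, -⟩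
    · exact ⟨0, t.succ_pos, q, h, by simp⟩
    · obtain ⟨k, hk, p, hV, hp⟩ := ih h
      exact ⟨k + 1, by omega, p, by simpa using hV, by grind⟩
    · obtain ⟨k, hk, p, hV, hp⟩ := ih h
      exact ⟨k + 1, by omega, p, by simpa using hV, by grind⟩

theorem burnSet_subset_biUnion_l1Ball (f : ℕ → ℕ) (V : ℕ → Option (ℤ × ℤ)) (t : ℕ) :
    burnSet f V t ⊆ (Finset.range t).biUnion fun k => l1Ball ((V (t - k)).getD 0) k := by
  intro q hq
  obtain ⟨k, hk, p, hV, hp⟩ := exists_activator_near hq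
  exact Finset.mem_biUnion.2 ⟨k, Finset.mem_range.2 hk, mem_l1Ball_of_le (by simpa [hV] using hp)⟩

theorem three_mul_sum_l1Ball_card (t : ℕ) :
    3 * ∑ k ∈ Finset.range t, (2 * k ^ 2 + 2 * k + 1) = 2 * t ^ 3 + t := by
  induction t with
  | zero => simp
  | succ t ih => rw [Finset.sum_range_succ, mul_add, ih]; ring

theorem three_mul_card_burnSet_le (f : ℕ → ℕ) (V : ℕ → Option (ℤ × ℤ)) (t : ℕ) :
    3 * (burnSet f V t).card ≤ 2 * t ^ 3 + t := by
  rw [← three_mul_sum_l1Ball_card]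
  gcongr
  exact (Finset.card_le_card (burnSet_subset_biUnion_l1Ball f V t)).trans
    (Finset.card_biUnion_le.trans (Finset.sum_le_sum fun k _ => card_l1Ball_le _ k))

/-- for strictly increasing `f`, (a) `B_t[i]` is the `L¹`-ball of radius
`t - i` centred at `v_i` in `ℤ × ℤ`, and (b) `|B_t| ≤ (2t³ + t)/3`. -/
theorem burnSet_ball_and_bound (f : ℕ → ℕ) (hf : StrictMono f)
    (V : ℕ → Option (ℤ × ℤ)) (hV : IsActivator f V) (t : ℕ) :
    (∀ i p, 1 ≤ i → i ≤ t → V i = some p →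
      ∀ q : ℤ × ℤ, q ∈ burnSet f (singleAct V i) t ↔
        |q.1 - p.1| + |q.2 - p.2| ≤ (t : ℤ) - (i : ℤ)) ∧
    ((burnSet f V t).card : ℝ) ≤ (2 * (t : ℝ) ^ 3 + t) / 3 := by
  refine ⟨fun i p hi hit hp q => ?_, ?_⟩
  · obtain ⟨k, rfl⟩ := Nat.exists_eq_add_of_le hit
    rw [mem_burnSet_singleAct hf hi hp (hV i hi p hp)]
    simp
  · rw [le_div_iff₀' three_pos]
    exact_mod_cast three_mul_card_burnSet_le f V t
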